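/- Fix an integer K ≥ 1 and let M_K ⊆ C(𝒞,𝒞) be the set of homeomorphisms of 𝒞 having exactly K ergodic invariant Borel probability measures. Then the map sending φ ∈ M_K to the set of its ergodic invariant Borel probability measures (a finite, hence nonempty compact, subset of the space of Borel probability measures on 𝒞) is Borel measurable from M_K to the space of nonempty compact subsets of the space of Borel probability measures on 𝒞, the latter equipped with the topology of weak convergence (e.g. the Lévy–Prokhorov metric) and the Hausdorff metric on compact subsets, with its Borel σ-algebra. -/

import Mathlib

open MeasureTheory TopologicalSpace Topology

abbrev Cantor : Type := ℤ → Bool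

def InvariantProb {X : Type*} [MeasurableSpace X] (φ : X → X)
    (μ : ProbabilityMeasure X) : Prop :=
  ∀ B : Set X, MeasurableSet B → μ.toMeasure (φ ⁻¹' B) = μ.toMeasure B

def ErgodicProb {X : Type*} [MeasurableSpace X] (φ : X → X)
    (μ : ProbabilityMeasure X) : Prop :=
  InvariantProb φ μ ∧ ∀ B : Set X, MeasurableSet B → φ ⁻¹' B = B →
    μ.toMeasure B = 0 ∨ μ.toMeasure B = 1

noncomputable instance : MeasurableSpace C(Cantor, Cantor) := borel _
instance : BorelSpace C(Cantor, Cantor) := ⟨rfl⟩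

/-- A metric compatible with the topology of weak convergence (e.g. the Lévy–Prokhorov
metric) on the space of Borel probability measures on the Cantor space. -/
noncomputable instance : MetricSpace (ProbabilityMeasure Cantor) :=
  TopologicalSpace.metrizableSpaceMetric _

noncomputable instance : MeasurableSpace (NonemptyCompacts (ProbabilityMeasure Cantor)) :=
  borel _
instance : BorelSpace (NonemptyCompacts (ProbabilityMeasure Cantor)) := ⟨rfl⟩

open Set

section Projection

/-- The projection along a compact space of the intersection of a closed set and an open set is
a countable union of closed sets. -/
theorem exists_isClosed_iUnion_eq_fst_image {X Y : Type*} [TopologicalSpace X]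
    [TopologicalSpace Y] [MetrizableSpace X] [MetrizableSpace Y] [CompactSpace Y]
    {C V : Set (X × Y)} (hC : IsClosed C) (hV : IsOpen V) :
    ∃ F : ℕ → Set X, (∀ n, IsClosed (F n)) ∧ Prod.fst '' (C ∩ V) = ⋃ n, F n := by
  let := metrizableSpaceMetric X
  let := metrizableSpaceMetric Y
  obtain ⟨F, hF, -, hFV, -⟩ := hV.exists_iUnion_isClosed
  refine ⟨fun n => Prod.fst '' (C ∩ F n), fun n => isClosedMap_fst_of_compactSpace _
    (hC.inter (hF n)), ?_⟩
  rw [← image_iUnion, ← inter_iUnion, hFV]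

theorem MeasureTheory.AnalyticSet.inter {α : Type*} [TopologicalSpace α] [T2Space α] {s t : Set α}
    (hs : AnalyticSet s) (ht : AnalyticSet t) : AnalyticSet (s ∩ t) := by
  rw [inter_eq_iInter]
  exact AnalyticSet.iInter fun b => by cases b <;> assumption

theorem IsOpen.analyticSet {α : Type*} [TopologicalSpace α] [PolishSpace α] {s : Set α}
    (hs : IsOpen s) : AnalyticSet s := by
  simpa using hs.analyticSet_image continuous_id

theorem polishSpace_of_compactSpace (X : Type*) [TopologicalSpace X] [CompactSpace X]
    [MetrizableSpace X] : PolishSpace X := by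
  let := metrizableSpaceMetric X
  infer_instance

theorem polishSpace_continuousMap (X : Type*) [TopologicalSpace X] [CompactSpace X]
    [MetrizableSpace X] : PolishSpace C(X, X) := by
  let := metrizableSpaceMetric X
  infer_instance

end Projection

theorem mutuallySingular_of_ergodic {X : Type*} [MeasurableSpace X] {φ : X → X}
    {μ ν : ProbabilityMeasure X}
    (hμ : Ergodic φ (μ : Measure X)) (hν : Ergodic φ (ν : Measure X)) (hne : μ ≠ ν) :
    (μ : Measure X) ⟂ₘ ν := by
  obtain ⟨c, hc⟩ := hν.eq_smul_of_absolutelyContinuous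
    (hμ.toMeasurePreserving.withDensity_rnDeriv hν.toMeasurePreserving)
    (withDensity_absolutelyContinuous _ _)
  rcases eq_or_ne c 0 with rfl | hc0
  · rwa [zero_smul, Measure.withDensity_rnDeriv_eq_zero] at hc
  · have hle : c • (ν : Measure X) ≤ μ := hc ▸ Measure.withDensity_rnDeriv_le _ _
    have hac : (ν : Measure X) ≪ μ :=
      (Measure.absolutelyContinuous_smul hc0).trans hle.absolutelyContinuous
    have heq : (ν : Measure X) = μ :=
      hμ.eq_of_absolutelyContinuous hν.toMeasurePreserving hac
    exact absurd (Subtype.ext heq).symm hne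

section Functional

variable {X : Type*} [TopologicalSpace X] [MeasurableSpace X] [BorelSpace X]

/-- The integration functional of a probability measure. -/
noncomputable def integralFunctional (μ : ProbabilityMeasure X) (f : C(X, ℝ)) : ℝ :=
  ∫ x, f x ∂(μ : Measure X)

theorem measure_eq_of_forall_integral_eq [MetrizableSpace X] {μ ν : Measure X}
    [IsFiniteMeasure μ] [IsFiniteMeasure ν] (h : ∀ f : C(X, ℝ), ∫ x, f x ∂μ = ∫ x, f x ∂ν) : μ = ν :=
  ext_of_forall_integral_eq_of_IsFiniteMeasure fun f => h f.toContinuousMap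

theorem integralFunctional_injective [MetrizableSpace X] :
    Function.Injective (integralFunctional : ProbabilityMeasure X → C(X, ℝ) → ℝ) :=
  fun μ ν h => Subtype.ext (measure_eq_of_forall_integral_eq (μ := (μ : Measure X))
    (ν := (ν : Measure X)) fun f => congrFun h f)

theorem measurePreserving_iff_forall_integral_eq [MetrizableSpace X] (φ : C(X, X))
    (μ : ProbabilityMeasure X) :
    MeasurePreserving φ (μ : Measure X) μ ↔
      ∀ f : C(X, ℝ), integralFunctional μ (f.comp φ) = integralFunctional μ f := by
  have hφ : Measurable φ := φ.continuous.measurable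
  have key (f : C(X, ℝ)) :
      ∫ x, f x ∂((μ : Measure X).map φ) = integralFunctional μ (f.comp φ) :=
    integral_map hφ.aemeasurable f.continuous.aestronglyMeasurable
  have : IsFiniteMeasure ((μ : Measure X).map φ) := inferInstance
  refine ⟨fun h f => ?_, fun h => ⟨hφ, measure_eq_of_forall_integral_eq fun f => ?_⟩⟩
  · rw [← key, h.map_eq]
    rfl
  · rw [key, h]
    rfl

variable [CompactSpace X]

theorem integrable_continuousMap (f : C(X, ℝ)) (μ : Measure X) [IsFiniteMeasure μ] :
    Integrable f μ :=
  (BoundedContinuousFunction.mkOfCompact f).integrable μ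

theorem continuous_integralFunctional :
    Continuous (integralFunctional : ProbabilityMeasure X → C(X, ℝ) → ℝ) :=
  continuous_pi fun f => ProbabilityMeasure.continuous_integral_continuousMap f

theorem integral_smul_add_smul (f : C(X, ℝ)) (μ ν : ProbabilityMeasure X) {a b : ENNReal}
    (ha : a ≠ ⊤) (hb : b ≠ ⊤) :
    ∫ x, f x ∂(a • (μ : Measure X) + b • (ν : Measure X)) =
      a.toReal * integralFunctional μ f + b.toReal * integralFunctional ν f := by
  rw [integral_add_measure ((integrable_continuousMap f _).smul_measure ha)
    ((integrable_continuousMap f _).smul_measure hb), integral_smul_measure,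
    integral_smul_measure]
  rfl

theorem continuous_integralFunctional_uncurry :
    Continuous fun p : ProbabilityMeasure X × C(X, ℝ) => integralFunctional p.1 p.2 := by
  rw [continuous_iff_continuousAt]
  rintro ⟨μ, f⟩
  have h0 : Filter.Tendsto (fun p : ProbabilityMeasure X × C(X, ℝ) =>
      integralFunctional p.1 f) (𝓝 (μ, f)) (𝓝 (integralFunctional μ f)) :=
    (((continuous_apply f).comp continuous_integralFunctional).comp continuous_fst).tendsto _
  have h1 : Filter.Tendsto (fun p : ProbabilityMeasure X × C(X, ℝ) => ‖p.2 - f‖)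
      (𝓝 (μ, f)) (𝓝 0) := by
    have : Continuous fun p : ProbabilityMeasure X × C(X, ℝ) => ‖p.2 - f‖ := by fun_prop
    simpa using this.tendsto (μ, f)
  have h2 : Filter.Tendsto (fun p : ProbabilityMeasure X × C(X, ℝ) =>
      integralFunctional p.1 (p.2 - f)) (𝓝 (μ, f)) (𝓝 0) := by
    refine squeeze_zero_norm (fun p => ?_) h1
    refine (norm_integral_le_of_norm_le_const
      (Filter.Eventually.of_forall fun x => (p.2 - f).norm_coe_le_norm x)).trans ?_
    simp
  have h3 := h0.add h2
  rw [add_zero] at h3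
  refine h3.congr fun p => ?_
  have := integral_sub (integrable_continuousMap p.2 (p.1 : Measure X))
    (integrable_continuousMap f (p.1 : Measure X))
  simp only [integralFunctional, ContinuousMap.sub_apply, this]
  ring

variable [MetrizableSpace X]

theorem integralFunctional_eq_iff (ρ μ ν : ProbabilityMeasure X) {a b : ENNReal}
    (ha : a ≠ ⊤) (hb : b ≠ ⊤) :
    integralFunctional ρ = a.toReal • integralFunctional μ + b.toReal • integralFunctional ν ↔
      (ρ : Measure X) = a • (μ : Measure X) + b • (ν : Measure X) := by
  have : IsFiniteMeasure (a • (μ : Measure X)) := Measure.smul_finite _ ha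
  have : IsFiniteMeasure (b • (ν : Measure X)) := Measure.smul_finite _ hb
  constructor
  · intro h
    refine measure_eq_of_forall_integral_eq fun f => ?_
    rw [integral_smul_add_smul f μ ν ha hb]
    exact congrFun h f
  · intro h
    ext f
    simp only [integralFunctional, h]
    exact integral_smul_add_smul f μ ν ha hb

theorem isClosed_setOf_measurePreserving :
    IsClosed {p : C(X, X) × ProbabilityMeasure X |
      MeasurePreserving p.1 (p.2 : Measure X) p.2} := by
  simp only [measurePreserving_iff_forall_integral_eq, ofPred_forall]
  refine isClosed_iInter fun f => isClosed_eq ?_ ?_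
  · exact continuous_integralFunctional_uncurry.comp
      (continuous_snd.prodMk ((ContinuousMap.continuous_postcomp f).comp continuous_fst))
  · exact ((continuous_apply f).comp continuous_integralFunctional).comp continuous_snd

/-- The integration functionals of the invariant probability measures. -/
def invariantFunctionals (φ : C(X, X)) : Set (C(X, ℝ) → ℝ) :=
  integralFunctional '' {μ | MeasurePreserving φ (μ : Measure X) μ}

theorem isCompact_invariantFunctionals (φ : C(X, X)) : IsCompact (invariantFunctionals φ) := by
  refine IsCompact.image (IsClosed.isCompact ?_) continuous_integralFunctional
  exact isClosed_setOf_measurePreserving.preimage (Continuous.prodMk_right φ)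

theorem convex_invariantFunctionals (φ : C(X, X)) : Convex ℝ (invariantFunctionals φ) := by
  rintro _ ⟨μ, hμ, rfl⟩ _ ⟨ν, hν, rfl⟩ a b ha hb hab
  have hsum : ENNReal.ofReal a + ENNReal.ofReal b = 1 := by
    rw [← ENNReal.ofReal_add ha hb, hab, ENNReal.ofReal_one]
  let ρ : ProbabilityMeasure X :=
    ⟨ENNReal.ofReal a • (μ : Measure X) + ENNReal.ofReal b • (ν : Measure X),
      ⟨by simp [hsum]⟩⟩
  refine ⟨ρ, (hμ.smul_measure _).add_measure (hν.smul_measure _), ?_⟩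
  have := (integralFunctional_eq_iff ρ μ ν (a := ENNReal.ofReal a) (b := ENNReal.ofReal b)
    ENNReal.ofReal_ne_top ENNReal.ofReal_ne_top).2 rfl
  rwa [ENNReal.toReal_ofReal ha, ENNReal.toReal_ofReal hb] at this

theorem ergodic_iff_mem_extremePoints_invariantFunctionals (φ : C(X, X))
    (μ : ProbabilityMeasure X) :
    Ergodic φ (μ : Measure X) ↔
      integralFunctional μ ∈ extremePoints ℝ (invariantFunctionals φ) := by
  rw [Ergodic.iff_mem_extremePoints, mem_extremePoints_iff_left, mem_extremePoints_iff_left]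
  constructor
  · rintro ⟨⟨hμ, -⟩, h⟩
    refine ⟨⟨μ, hμ, rfl⟩, ?_⟩
    rintro _ ⟨ν₁, h₁, rfl⟩ _ ⟨ν₂, h₂, rfl⟩ ⟨a, b, ha, hb, hab, hμν⟩
    have hsum : ENNReal.ofReal a + ENNReal.ofReal b = 1 := by
      rw [← ENNReal.ofReal_add ha.le hb.le, hab, ENNReal.ofReal_one]
    have := (integralFunctional_eq_iff μ ν₁ ν₂ (a := ENNReal.ofReal a)
      (b := ENNReal.ofReal b) ENNReal.ofReal_ne_top ENNReal.ofReal_ne_top).1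
      (by rw [ENNReal.toReal_ofReal ha.le, ENNReal.toReal_ofReal hb.le, hμν])
    exact congrArg _ (Subtype.ext (h ν₁ ⟨h₁, inferInstance⟩ ν₂ ⟨h₂, inferInstance⟩
      ⟨_, _, by simpa using ha, by simpa using hb, hsum, this.symm⟩))
  · rintro ⟨⟨μ', hμ', hμμ'⟩, h⟩
    obtain rfl := integralFunctional_injective hμμ'
    refine ⟨⟨hμ', inferInstance⟩, ?_⟩
    rintro ν₁ ⟨h₁, i₁⟩ ν₂ ⟨h₂, i₂⟩ ⟨a, b, ha, hb, hab, hμν⟩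
    have ha' : a ≠ ⊤ := ne_top_of_le_ne_top ENNReal.one_ne_top (hab ▸ le_self_add)
    have hb' : b ≠ ⊤ := ne_top_of_le_ne_top ENNReal.one_ne_top (hab ▸ le_add_self)
    have := (integralFunctional_eq_iff μ' ⟨ν₁, i₁⟩ ⟨ν₂, i₂⟩ ha' hb').2 hμν.symm
    refine congrArg Subtype.val (integralFunctional_injective (h _ ⟨⟨ν₁, i₁⟩, h₁, rfl⟩ _
      ⟨⟨ν₂, i₂⟩, h₂, rfl⟩ ⟨a.toReal, b.toReal, ENNReal.toReal_pos ha.ne' ha',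
      ENNReal.toReal_pos hb.ne' hb', ?_, this.symm⟩))
    rw [← ENNReal.toReal_add ha' hb', hab, ENNReal.toReal_one]

theorem analyticSet_setOf_ergodic :
    AnalyticSet {p : C(X, X) × ProbabilityMeasure X | Ergodic p.1 (p.2 : Measure X)} := by
  have := polishSpace_continuousMap X
  have := polishSpace_of_compactSpace (ProbabilityMeasure X)
  let C : Set ((C(X, X) × ProbabilityMeasure X) ×
      ProbabilityMeasure X × ProbabilityMeasure X × unitInterval) :=
    {q | MeasurePreserving q.1.1 (q.2.1 : Measure X) q.2.1 ∧
      MeasurePreserving q.1.1 (q.2.2.1 : Measure X) q.2.2.1 ∧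
      (1 - q.2.2.2 : ℝ) • integralFunctional q.2.1 +
        (q.2.2.2 : ℝ) • integralFunctional q.2.2.1 = integralFunctional q.1.2}
  let V : Set ((C(X, X) × ProbabilityMeasure X) ×
      ProbabilityMeasure X × ProbabilityMeasure X × unitInterval) :=
    {q | q.2.1 ≠ q.1.2 ∧ (q.2.2.2 : ℝ) ≠ 0 ∧ (q.2.2.2 : ℝ) ≠ 1}
  have hC : IsClosed C := by
    have hT := continuous_integralFunctional (X := X)
    refine IsClosed.and ?_ (IsClosed.and ?_ ?_)
    · exact isClosed_setOf_measurePreserving.preimage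
        (f := fun q : (C(X, X) × ProbabilityMeasure X) ×
          ProbabilityMeasure X × ProbabilityMeasure X × unitInterval =>
          (q.1.1, q.2.1)) (by fun_prop)
    · exact isClosed_setOf_measurePreserving.preimage
        (f := fun q : (C(X, X) × ProbabilityMeasure X) ×
          ProbabilityMeasure X × ProbabilityMeasure X × unitInterval =>
          (q.1.1, q.2.2.1)) (by fun_prop)
    · exact isClosed_eq (by fun_prop) (by fun_prop)
  have hV : IsOpen V := by
    refine IsOpen.and ?_ (IsOpen.and ?_ ?_)
    · exact isOpen_ne_fun (by fun_prop) (by fun_prop)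
    · exact isOpen_ne_fun (by fun_prop) (by fun_prop)
    · exact isOpen_ne_fun (by fun_prop) (by fun_prop)
  obtain ⟨F, hF, hFeq⟩ := exists_isClosed_iUnion_eq_fst_image hC hV
  have : {p : C(X, X) × ProbabilityMeasure X | Ergodic p.1 (p.2 : Measure X)} =
      {p | MeasurePreserving p.1 (p.2 : Measure X) p.2} ∩ ⋂ n, (F n)ᶜ := by
    rw [← compl_iUnion, ← hFeq]
    ext ⟨φ, μ⟩
    simp only [mem_ofPred_eq, mem_inter_iff, mem_compl_iff]
    rw [ergodic_iff_mem_extremePoints_invariantFunctionals, mem_extremePoints_iff_left]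
    refine and_congr ⟨?_, fun h => ⟨μ, h, rfl⟩⟩ ⟨?_, ?_⟩
    · rintro ⟨ν, hν, h⟩
      exact integralFunctional_injective h ▸ hν
    · rintro h ⟨⟨_, ν₁, ν₂, t⟩, ⟨⟨h₁, h₂, heq⟩, hne, h0, h1⟩, rfl⟩
      have ht0 := t.2.1
      have ht1 := t.2.2
      refine hne (integralFunctional_injective (h _ ⟨ν₁, h₁, rfl⟩ _ ⟨ν₂, h₂, rfl⟩
        ⟨1 - t, t, sub_pos.2 (lt_of_le_of_ne ht1 h1), lt_of_le_of_ne ht0 (Ne.symm h0),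
          by ring, heq⟩))
    · rintro h _ ⟨ν₁, h₁, rfl⟩ _ ⟨ν₂, h₂, rfl⟩ ⟨a, b, ha, hb, hab, heq⟩
      by_contra hne
      obtain rfl : a = 1 - b := by linarith
      refine h ⟨⟨⟨φ, μ⟩, ν₁, ν₂, ⟨b, hb.le, by linarith⟩⟩, ⟨⟨h₁, h₂, heq⟩,
        fun he => hne (congrArg _ he), hb.ne', ?_⟩, rfl⟩
      exact (by linarith : b < 1).ne
  rw [this]
  exact AnalyticSet.inter isClosed_setOf_measurePreserving.analyticSet
    (AnalyticSet.iInter fun n => (hF n).isOpen_compl.analyticSet)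

/-- If there are at most `K` ergodic measures, then any `K + 1` invariant measures are linearly
dependent. -/
theorem det_integralFunctional_eq_zero (φ : C(X, X)) {K : ℕ}
    (hfin : {μ : ProbabilityMeasure X | Ergodic φ (μ : Measure X)}.Finite)
    (hcard : {μ : ProbabilityMeasure X | Ergodic φ (μ : Measure X)}.ncard = K)
    (μ : Fin (K + 1) → ProbabilityMeasure X)
    (hμ : ∀ i, MeasurePreserving φ (μ i : Measure X) (μ i)) (f : Fin (K + 1) → C(X, ℝ)) :
    (Matrix.of fun i j => integralFunctional (μ j) (f i)).det = 0 := by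
  set E := {μ : ProbabilityMeasure X | Ergodic φ (μ : Measure X)} with hE
  have hsub : extremePoints ℝ (invariantFunctionals φ) ⊆ integralFunctional '' E := by
    intro x hx
    obtain ⟨ν, -, rfl⟩ := hx.1
    exact ⟨ν, (ergodic_iff_mem_extremePoints_invariantFunctionals φ ν).2 hx, rfl⟩
  have hinv : invariantFunctionals φ ⊆ convexHull ℝ (integralFunctional '' E) := by
    rw [← closure_convexHull_extremePoints (isCompact_invariantFunctionals φ)
      (convex_invariantFunctionals φ)]
    exact closure_minimal (convexHull_mono hsub)
      ((hfin.image _).isClosed_convexHull ℝ)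
  let W := Submodule.span ℝ (integralFunctional '' E)
  have hmem (i) : integralFunctional (μ i) ∈ W :=
    (convexHull_min Submodule.subset_span W.convex) (hinv ⟨μ i, hμ i, rfl⟩)
  have : FiniteDimensional ℝ W := FiniteDimensional.span_of_finite ℝ (hfin.image _)
  have hrank : Module.finrank ℝ W ≤ K := by
    have := (hfin.image (integralFunctional (X := X))).fintype
    refine (finrank_span_le_card _).trans ?_
    rw [← ncard_eq_toFinset_card', ← hcard]
    exact ncard_image_le hfin
  have hdep : ¬ LinearIndependent ℝ fun i => (⟨integralFunctional (μ i), hmem i⟩ : W) := by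
    intro h
    have := h.fintype_card_le_finrank
    rw [Fintype.card_fin] at this
    omega
  obtain ⟨c, hc, i, hi⟩ := Fintype.not_linearIndependent_iff.1 hdep
  refine Matrix.exists_mulVec_eq_zero_iff.1 ⟨c, fun h => hi (congrFun h i), ?_⟩
  ext j
  have := congrFun (congrArg Subtype.val hc) (f j)
  simpa [Matrix.mulVec, dotProduct, mul_comm] using this

/-- Finitely many distinct ergodic measures are linearly independent. -/
theorem exists_det_integralFunctional_ne_zero {φ : X → X} {n : ℕ}
    (μ : Fin n → ProbabilityMeasure X) (hinj : Function.Injective μ)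
    (hμ : ∀ i, Ergodic φ (μ i : Measure X)) :
    ∃ f : Fin n → C(X, ℝ),
      (Matrix.of fun i j => integralFunctional (μ j) (f i)).det ≠ 0 := by
  have hsing (i : Fin n) : ∃ T : Set X, MeasurableSet T ∧
      ∀ j, (μ j : Measure X).real T = if j = i then 1 else 0 := by
    have h : (μ i : Measure X) ⟂ₘ
        Measure.sum fun j : {j // j ≠ i} => (μ j : Measure X) :=
      Measure.MutuallySingular.sum_right.2 fun j =>
        mutuallySingular_of_ergodic (hμ i) (hμ j) fun h => j.2 (hinj h).symm
    refine ⟨h.nullSetᶜ, h.measurableSet_nullSet.compl, fun j => ?_⟩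
    split_ifs with hj
    · subst hj
      rw [probReal_compl_eq_one_sub h.measurableSet_nullSet]
      simp [Measure.real]
    · have := Measure.le_sum (fun j : {j // j ≠ i} => (μ j : Measure X)) ⟨j, hj⟩ h.nullSetᶜ
      rw [h.measure_compl_nullSet] at this
      simp [Measure.real, nonpos_iff_eq_zero.1 this]
  choose T hTm hT using hsing
  let ρ : Measure X := Measure.sum fun j => (μ j : Measure X)
  have hle (j) : (μ j : Measure X) ≤ ρ := Measure.le_sum (fun j => (μ j : Measure X)) j
  have hε : (0 : ℝ) < 1 / (n + 1) := by positivity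
  have happrox (i : Fin n) : ∃ f : C(X, ℝ), ∀ j,
      ‖integralFunctional (μ j) f - if j = i then 1 else 0‖ ≤ 1 / (n + 1) := by
    have hint : Integrable ((T i).indicator fun _ => (1 : ℝ)) ρ :=
      (integrable_const 1).indicator (hTm i)
    obtain ⟨g, hg, hgi⟩ := hint.exists_boundedContinuous_integral_sub_le hε
    refine ⟨g.toContinuousMap, fun j => ?_⟩
    have h1 : ((if j = i then 1 else 0 : ℝ)) =
        ∫ x, (T i).indicator (fun _ => (1 : ℝ)) x ∂(μ j : Measure X) := by
      rw [integral_indicator_const _ (hTm i), hT i j, smul_eq_mul, mul_one]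
    rw [h1, norm_sub_rev]
    refine le_trans ?_ hg
    change ‖_ - ∫ x, g x ∂(μ j : Measure X)‖ ≤ _
    rw [← integral_sub (hint.mono_measure (hle j)) (hgi.mono_measure (hle j))]
    refine (norm_integral_le_integral_norm _).trans ?_
    exact integral_mono_measure (hle j) (Filter.Eventually.of_forall fun x => norm_nonneg _)
      (hint.sub hgi).norm
  choose f hf using happrox
  refine ⟨f, det_ne_zero_of_sum_row_lt_diag fun k => ?_⟩
  have hdiag : 1 - 1 / ((n : ℝ) + 1) ≤ ‖integralFunctional (μ k) (f k)‖ := by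
    have := hf k k
    rw [if_pos rfl, Real.norm_eq_abs, abs_le] at this
    exact le_trans (by linarith) (le_abs_self _)
  have hoff : ∑ j ∈ Finset.univ.erase k, ‖integralFunctional (μ j) (f k)‖ ≤
      (n - 1) * (1 / ((n : ℝ) + 1)) := by
    refine (Finset.sum_le_card_nsmul _ _ (1 / ((n : ℝ) + 1)) fun j hj => ?_).trans ?_
    · simpa [Finset.ne_of_mem_erase hj] using hf k j
    · rw [Finset.card_erase_of_mem (Finset.mem_univ k), Finset.card_univ, Fintype.card_fin,
        nsmul_eq_mul, Nat.cast_sub (Nat.one_le_of_lt k.pos), Nat.cast_one]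
  refine hoff.trans_lt (lt_of_lt_of_le ?_ hdiag)
  have : (n + 1 : ℝ) * (1 / (n + 1)) = 1 := by field_simp
  linarith

/-- The maps admitting `n` linearly independent invariant probability measures. -/
def independentInvariant (X : Type*) [TopologicalSpace X] [CompactSpace X] [MetrizableSpace X]
    [MeasurableSpace X] [BorelSpace X] (n : ℕ) : Set C(X, X) :=
  {φ | ∃ μ : Fin n → ProbabilityMeasure X,
    (∀ i, MeasurePreserving φ (μ i : Measure X) (μ i)) ∧
    ∃ f : Fin n → C(X, ℝ), (Matrix.of fun i j => integralFunctional (μ j) (f i)).det ≠ 0}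

theorem analyticSet_compl_independentInvariant (n : ℕ) :
    AnalyticSet (independentInvariant X n)ᶜ := by
  have := polishSpace_continuousMap X
  let C : Set (C(X, X) × (Fin n → ProbabilityMeasure X)) :=
    {q | ∀ i, MeasurePreserving q.1 (q.2 i : Measure X) (q.2 i)}
  let V : Set (C(X, X) × (Fin n → ProbabilityMeasure X)) :=
    ⋃ f : Fin n → C(X, ℝ),
      {q | (Matrix.of fun i j => integralFunctional (q.2 j) (f i)).det ≠ 0}
  have hC : IsClosed C := by
    have : C = ⋂ i, {q | MeasurePreserving q.1 (q.2 i : Measure X) (q.2 i)} := by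
      ext q
      simp [C]
    rw [this]
    exact isClosed_iInter fun i => isClosed_setOf_measurePreserving.preimage
      (f := fun q : C(X, X) × (Fin n → ProbabilityMeasure X) => (q.1, q.2 i)) (by fun_prop)
  have hV : IsOpen V := by
    refine isOpen_iUnion fun f => isOpen_ne_fun (Continuous.matrix_det ?_) continuous_const
    refine continuous_matrix fun i j => ?_
    exact (ProbabilityMeasure.continuous_integral_continuousMap (f i)).comp
      ((continuous_apply j).comp continuous_snd)
  obtain ⟨F, hF, hFeq⟩ := exists_isClosed_iUnion_eq_fst_image hC hV
  have : (independentInvariant X n)ᶜ = ⋂ n, (F n)ᶜ := by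
    rw [← compl_iUnion, ← hFeq]
    congr 1
    ext φ
    simp [independentInvariant, C, V]
  rw [this]
  exact AnalyticSet.iInter fun n => (hF n).isOpen_compl.analyticSet

theorem analyticSet_setOf_exists_injective_ergodic (n : ℕ) {U : Set (ProbabilityMeasure X)}
    (hU : AnalyticSet U) :
    AnalyticSet {φ : C(X, X) | ∃ μ : Fin n → ProbabilityMeasure X, Function.Injective μ ∧
      ∀ i, Ergodic φ (μ i : Measure X) ∧ μ i ∈ U} := by
  have := polishSpace_continuousMap X
  have := polishSpace_of_compactSpace (ProbabilityMeasure X)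
  let D : Set (C(X, X) × (Fin n → ProbabilityMeasure X)) := {q | Function.Injective q.2}
  let S (i : Fin n) : Set (C(X, X) × (Fin n → ProbabilityMeasure X)) :=
    {q | Ergodic q.1 (q.2 i : Measure X)} ∩ {q | q.2 i ∈ U}
  have hD : IsOpen D := by
    have : D = ⋂ i, ⋂ j, ⋂ _ : i ≠ j, {q | q.2 i ≠ q.2 j} := by
      ext q
      simp only [D, mem_ofPred_eq, mem_iInter, Function.Injective, ne_eq, not_imp_not]
    rw [this]
    exact isOpen_iInter_of_finite fun i => isOpen_iInter_of_finite fun j =>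
      isOpen_iInter_of_finite fun _ => isOpen_ne_fun (by fun_prop) (by fun_prop)
  have hS (i) : AnalyticSet (S i) :=
    AnalyticSet.inter (analyticSet_setOf_ergodic.preimage
      (f := fun q : C(X, X) × (Fin n → ProbabilityMeasure X) => (q.1, q.2 i)) (by fun_prop))
      (hU.preimage (f := fun q : C(X, X) × (Fin n → ProbabilityMeasure X) => q.2 i)
        (by fun_prop))
  have hall : AnalyticSet (⋂ o : Option (Fin n), o.elim D S) :=
    AnalyticSet.iInter fun o => by
      cases o with
      | none => exact hD.analyticSet
      | some i => exact hS i
  convert hall.image_of_continuous continuous_fst using 1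
  ext φ
  simp [iInter_option, D, S]

/-- On the maps with exactly `K` ergodic measures, having an ergodic measure in a given Borel set
is a relatively Borel condition. -/
theorem exists_measurableSet_forall_mem_iff [MeasurableSpace C(X, X)] [BorelSpace C(X, X)]
    {K : ℕ} (hK : 1 ≤ K) {U : Set (ProbabilityMeasure X)} (hU : AnalyticSet U)
    (hU' : AnalyticSet Uᶜ) :
    ∃ B : Set C(X, X), MeasurableSet B ∧ ∀ φ : C(X, X),
      {μ : ProbabilityMeasure X | Ergodic φ (μ : Measure X)}.ncard = K →
        (φ ∈ B ↔ ({μ : ProbabilityMeasure X | Ergodic φ (μ : Measure X)} ∩ U).Nonempty) := by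
  have hG := analyticSet_compl_independentInvariant (X := X) (K + 1)
  obtain ⟨B, hAB, hB, hBm⟩ :=
    ((analyticSet_setOf_exists_injective_ergodic 1 hU).inter hG).measurablySeparable
      ((analyticSet_setOf_exists_injective_ergodic K hU').inter hG) (by
    rw [disjoint_left]
    rintro φ ⟨⟨μ, -, hμ⟩, hφ⟩ ⟨⟨ν, hν, hνU⟩, -⟩
    have herg : ∀ i, Ergodic φ
        ((Fin.cons (μ 0) ν : Fin (K + 1) → ProbabilityMeasure X) i : Measure X) :=
      Fin.cases (hμ 0).1 fun i => (hνU i).1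
    have hinj : Function.Injective (Fin.cons (μ 0) ν : Fin (K + 1) → ProbabilityMeasure X) := by
      refine Fin.cons_injective_iff.2 ⟨?_, hν⟩
      rintro ⟨i, hi⟩
      exact (hνU i).2 (hi ▸ (hμ 0).2)
    exact hφ ⟨_, fun i => (herg i).toMeasurePreserving,
      exists_det_integralFunctional_ne_zero _ hinj herg⟩)
  refine ⟨B, hBm, fun φ hφ => ?_⟩
  have hfin : {μ : ProbabilityMeasure X | Ergodic φ (μ : Measure X)}.Finite :=
    finite_of_ncard_pos (by omega)
  have hφG : φ ∈ (independentInvariant X (K + 1))ᶜ := by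
    rintro ⟨μ, hμ, f, hf⟩
    exact hf (det_integralFunctional_eq_zero φ hfin hφ μ hμ f)
  constructor
  · intro hφB
    by_contra hne
    rw [not_nonempty_iff_eq_empty, ← disjoint_iff_inter_eq_empty, disjoint_left] at hne
    have := hfin.fintype
    have hcard : Fintype.card {μ : ProbabilityMeasure X | Ergodic φ (μ : Measure X)} = K := by
      rw [← hφ, ← Nat.card_eq_fintype_card]
      rfl
    let e := (Fintype.equivFinOfCardEq hcard).symm
    exact disjoint_left.1 hB ⟨⟨fun i => e i, Subtype.val_injective.comp e.injective,
      fun i => ⟨(e i).2, hne (e i).2⟩⟩, hφG⟩ hφB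
  · rintro ⟨μ, hμ, hμU⟩
    exact hAB ⟨⟨fun _ => μ, Function.injective_of_subsingleton _, fun _ => ⟨hμ, hμU⟩⟩, hφG⟩

end Functional

theorem ergodicProb_iff_ergodic {X : Type*} [MeasurableSpace X] {φ : X → X} (hφ : Measurable φ)
    (μ : ProbabilityMeasure X) : ErgodicProb φ μ ↔ Ergodic φ (μ : Measure X) := by
  constructor
  · rintro ⟨hinv, h⟩
    refine ⟨⟨hφ, Measure.ext fun s hs => ?_⟩, ⟨fun s hs hs' => ?_⟩⟩
    · rw [Measure.map_apply hφ hs]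
      exact hinv s hs
    · rw [Filter.eventuallyConst_set']
      rcases h s hs hs' with h0 | h1
      · exact Or.inl (ae_eq_empty.2 h0)
      · exact Or.inr (ae_eq_univ.2 ((prob_compl_eq_zero_iff hs).2 h1))
  · intro h
    exact ⟨fun s hs => h.toMeasurePreserving.measure_preimage hs.nullMeasurableSet,
      fun s hs hs' => h.toPreErgodic.prob_eq_zero_or_one hs hs'⟩

/-- A map into the space of nonempty compact subsets is Borel measurable as soon as the preimages
of the sets of compacts meeting an open or a closed set are measurable. -/
theorem measurable_nonemptyCompacts {α P : Type*} [MeasurableSpace α] [TopologicalSpace P]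
    [SecondCountableTopology (NonemptyCompacts P)] [MeasurableSpace (NonemptyCompacts P)]
    [BorelSpace (NonemptyCompacts P)] {Θ : α → NonemptyCompacts P}
    (h : ∀ U : Set P, IsOpen U ∨ IsClosed U →
      MeasurableSet {a | ((Θ a : Set P) ∩ U).Nonempty}) :
    Measurable Θ := by
  have htop : (NonemptyCompacts.topology : TopologicalSpace (NonemptyCompacts P)) =
      .generateFrom _ := induced_generateFrom_eq
  rw [BorelSpace.measurable_eq (α := NonemptyCompacts P), borel_eq_generateFrom_of_subbasis htop]
  refine measurable_generateFrom ?_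
  rintro _ ⟨_, ⟨U, hU, rfl⟩ | ⟨U, hU, rfl⟩, rfl⟩
  · convert (h Uᶜ (Or.inr (IsOpen.isClosed_compl hU))).compl using 1
    ext a
    simp [not_nonempty_iff_eq_empty, ← disjoint_iff_inter_eq_empty, disjoint_compl_right_iff_subset]
  · exact h U (Or.inl hU)

theorem stmt1 (K : ℕ) (hK : 1 ≤ K)
    (MK : Set C(Cantor, Cantor))
    (hMK : MK = {φ : C(Cantor, Cantor) |
      IsHomeomorph (φ : Cantor → Cantor) ∧
      {μ : ProbabilityMeasure Cantor | ErgodicProb (φ : Cantor → Cantor) μ}.ncard = K})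
    (Θ : MK → NonemptyCompacts (ProbabilityMeasure Cantor))
    (hΘ : ∀ φ : MK, (Θ φ : Set (ProbabilityMeasure Cantor)) =
      {μ : ProbabilityMeasure Cantor | ErgodicProb ((φ : C(Cantor, Cantor)) : Cantor → Cantor) μ}) :
    Measurable Θ := by
  subst hMK
  have := polishSpace_of_compactSpace (ProbabilityMeasure Cantor)
  have herg (φ : C(Cantor, Cantor)) : {μ : ProbabilityMeasure Cantor | ErgodicProb φ μ} =
      {μ : ProbabilityMeasure Cantor | Ergodic φ (μ : Measure Cantor)} := by
    ext μ
    exact ergodicProb_iff_ergodic φ.continuous.measurable μ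
  refine measurable_nonemptyCompacts fun U hU => ?_
  obtain ⟨hU, hU'⟩ : AnalyticSet U ∧ AnalyticSet Uᶜ := by
    rcases hU with hU | hU
    · exact ⟨hU.analyticSet, hU.isClosed_compl.analyticSet⟩
    · exact ⟨hU.analyticSet, hU.isOpen_compl.analyticSet⟩
  obtain ⟨B, hB, h⟩ := exists_measurableSet_forall_mem_iff hK hU hU'
  convert measurable_subtype_coe hB using 1
  ext φ
  have hφ := φ.2
  rw [mem_ofPred_eq, herg] at hφ
  rw [mem_ofPred_eq, hΘ, herg, mem_preimage, h φ hφ.2]
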